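/- Perturbation bound for the canonical ESPRIT matrices: Let A ∈ ℂ^{(M+1)×S} with M ≥ S be a Vandermonde matrix with entries exp(i2π(k−1)ω_i), ω₁,…,ω_S ∈ [0,1) distinct; P = diag(p₁,…,p_S) with p_i > 0, σ² ≥ 0, T = A P Aᴴ + σ²I; T̂ Hermitian with E = T − T̂. Let U, Û have orthonormal columns spanning the top-S eigenspaces of T and T̂, let UᴴÛ = L Σ_c Rᴴ be a singular value decomposition, and define the canonical bases U^c = UL, Û^c = ÛR; let U₀^c, U₁^c (resp. Û₀^c, Û₁^c) be the first and last M rows of U^c (resp. Û^c), and Ψ^c = (U₀^c)†U₁^c, Ψ̂^c = (Û₀^c)†Û₁^c. If p_min σ_S(A)² > σ² and ‖E‖₂ ≤ σ_S(U₀^c)·(σ_S(APAᴴ) − σ²)/(4√2), then ‖Ψ^c − Ψ̂^c‖₂ ≤ 14√2 ‖E‖₂ / ( σ_S(U₀^c)² · (p_min σ_S(A)² − σ²) ). -/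

import Mathlib

open Matrix

noncomputable section

/-- Spectral norm (largest singular value) of a complex matrix. -/
def specNorm {m n : ℕ} (A : Matrix (Fin m) (Fin n) ℂ) : ℝ :=
  ‖LinearMap.toContinuousLinearMap (Matrix.toEuclideanLin A)‖

/-- `k`-th largest singular value (Courant–Fischer min-max characterization). -/
def sval {m n : ℕ} (A : Matrix (Fin m) (Fin n) ℂ) (k : ℕ) : ℝ :=
  sSup {r : ℝ | 0 ≤ r ∧ ∃ V : Submodule ℂ (EuclideanSpace ℂ (Fin n)),
    Module.finrank ℂ V = k ∧ ∀ x ∈ V, r * ‖x‖ ≤ ‖Matrix.toEuclideanLin A x‖}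

/-- Vandermonde matrix with unit-modulus nodes: entries `e^{i2π(k−1)ω_i}`. -/
def vandermonde (K S : ℕ) (ω : Fin S → ℝ) : Matrix (Fin K) (Fin S) ℂ :=
  Matrix.of fun m n => Complex.exp (Complex.I * (2 * Real.pi * (m : ℕ) * ω n))

/-- Moore–Penrose pseudoinverse of a full-column-rank matrix. -/
def pinv {m n : ℕ} (B : Matrix (Fin m) (Fin n) ℂ) : Matrix (Fin n) (Fin m) ℂ :=
  (Bᴴ * B)⁻¹ * Bᴴ

/-- First `M` rows. -/
def rowsInit {M S : ℕ} (U : Matrix (Fin (M + 1)) (Fin S) ℂ) : Matrix (Fin M) (Fin S) ℂ :=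
  U.submatrix Fin.castSucc id

/-- Last `M` rows. -/
def rowsTail {M S : ℕ} (U : Matrix (Fin (M + 1)) (Fin S) ℂ) : Matrix (Fin M) (Fin S) ℂ :=
  U.submatrix Fin.succ id

/-- The ESPRIT matrix `Ψ = U₀† U₁`. -/
def espritMat {M S : ℕ} (U : Matrix (Fin (M + 1)) (Fin S) ℂ) : Matrix (Fin S) (Fin S) ℂ :=
  pinv (rowsInit U) * rowsTail U

/-- `U` has orthonormal columns which are eigenvectors of `T` spanning the eigenspace of the
`S` largest eigenvalues of `T`. -/
def IsTopEigenbasis {N S : ℕ} (T : Matrix (Fin N) (Fin N) ℂ) (U : Matrix (Fin N) (Fin S) ℂ) :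
    Prop :=
  Uᴴ * U = 1 ∧ ∃ μ : Fin S → ℝ,
    T * U = U * Matrix.diagonal (fun i => (μ i : ℂ)) ∧
    ∀ (ν : ℝ) (v : Fin N → ℂ), v ≠ 0 → T.mulVec v = (ν : ℂ) • v →
      Uᴴ.mulVec v = 0 → ∀ i, ν ≤ μ i

end

section EspritHelpers

open scoped Matrix.Norms.L2Operator

lemma esp_apply {m n : ℕ} (A : Matrix (Fin m) (Fin n) ℂ) (x : EuclideanSpace ℂ (Fin n)) :
    toEuclideanLin A x = WithLp.toLp 2 (A *ᵥ WithLp.ofLp x) := rfl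

lemma esp_mul {l m n : ℕ} (A : Matrix (Fin l) (Fin m) ℂ) (B : Matrix (Fin m) (Fin n) ℂ)
    (x : EuclideanSpace ℂ (Fin n)) :
    toEuclideanLin (A * B) x = toEuclideanLin A (toEuclideanLin B x) := by
  simp [esp_apply, Matrix.mulVec_mulVec]

lemma esp_adj {m n : ℕ} (A : Matrix (Fin m) (Fin n) ℂ) (x : EuclideanSpace ℂ (Fin n))
    (y : EuclideanSpace ℂ (Fin m)) :
    inner ℂ (toEuclideanLin A x) y = inner ℂ x (toEuclideanLin Aᴴ y) := by
  rw [Matrix.toEuclideanLin_conjTranspose_eq_adjoint, LinearMap.adjoint_inner_right]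

lemma esp_le {m n : ℕ} (A : Matrix (Fin m) (Fin n) ℂ) (x : EuclideanSpace ℂ (Fin n)) :
    ‖toEuclideanLin A x‖ ≤ ‖A‖ * ‖x‖ := Matrix.l2_opNorm_mulVec A x

lemma esp_opNorm_le {m n : ℕ} (A : Matrix (Fin m) (Fin n) ℂ) (c : ℝ) (hc : 0 ≤ c)
    (h : ∀ x, ‖toEuclideanLin A x‖ ≤ c * ‖x‖) : ‖A‖ ≤ c := by
  rw [l2_opNorm_def]
  exact ContinuousLinearMap.opNorm_le_bound _ hc h

lemma esp_specNorm {m n : ℕ} (A : Matrix (Fin m) (Fin n) ℂ) : specNorm A = ‖A‖ := rfl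

lemma esp_herm_bound {n : ℕ} (G : Matrix (Fin n) (Fin n) ℂ) (hG : G.IsHermitian) (b : ℝ)
    (hb : 0 ≤ b)
    (h : ∀ (η : ℝ) (v : EuclideanSpace ℂ (Fin n)), v ≠ 0 →
      toEuclideanLin G v = (η : ℂ) • v → |η| ≤ b) : ‖G‖ ≤ b := by
  refine esp_opNorm_le G b hb fun x => ?_
  have hev : ∀ i, toEuclideanLin G (hG.eigenvectorBasis i) =
      (hG.eigenvalues i : ℂ) • hG.eigenvectorBasis i := by
    intro i
    have := hG.mulVec_eigenvectorBasis i
    rw [esp_apply, this]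
    ext j
    simp
  have hη : ∀ i, |hG.eigenvalues i| ≤ b := fun i =>
    h _ _ (hG.eigenvectorBasis.orthonormal.ne_zero i) (hev i)
  refine (sq_le_sq₀ (norm_nonneg _) (by positivity)).mp ?_
  rw [mul_pow, ← hG.eigenvectorBasis.sum_sq_norm_inner_right,
    ← hG.eigenvectorBasis.sum_sq_norm_inner_right x, Finset.mul_sum]
  refine Finset.sum_le_sum fun i _ => ?_
  have : inner ℂ (hG.eigenvectorBasis i) (toEuclideanLin G x) =
      (hG.eigenvalues i : ℂ) * inner ℂ (hG.eigenvectorBasis i) x := by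
    have h0 := esp_adj G (hG.eigenvectorBasis i) x
    rw [hG.eq, hev, inner_smul_left] at h0
    rw [← h0]
    simp
  rw [this, norm_mul, mul_pow]
  gcongr
  simpa using hη i

/-- orthogonal projections have norm at most one -/
lemma esp_proj {n : ℕ} (P : Matrix (Fin n) (Fin n) ℂ) (h1 : Pᴴ = P) (h2 : P * P = P) :
    ‖P‖ ≤ 1 := by
  have := l2_opNorm_conjTranspose_mul_self P
  rw [h1, h2] at this
  by_contra hc
  push Not at hc
  nlinarith

lemma esp_one (n : ℕ) : ‖(1 : Matrix (Fin n) (Fin n) ℂ)‖ ≤ 1 :=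
  esp_proj 1 (by simp) (by simp)

lemma esp_isom {m n : ℕ} (U : Matrix (Fin m) (Fin n) ℂ) (h : Uᴴ * U = 1) : ‖U‖ ≤ 1 := by
  have := l2_opNorm_conjTranspose_mul_self U
  rw [h] at this
  have h1 := esp_one n
  by_contra hc
  push Not at hc
  nlinarith

lemma esp_isom_norm {m n : ℕ} (U : Matrix (Fin m) (Fin n) ℂ) (h : Uᴴ * U = 1)
    (x : EuclideanSpace ℂ (Fin n)) : ‖toEuclideanLin U x‖ = ‖x‖ := by
  have : inner ℂ (toEuclideanLin U x) (toEuclideanLin U x) = inner ℂ x x := by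
    rw [esp_adj, ← esp_mul, h]; simp
  rw [inner_self_eq_norm_sq_to_K, inner_self_eq_norm_sq_to_K] at this
  have h2 : ‖toEuclideanLin U x‖ ^ 2 = ‖x‖ ^ 2 := by exact_mod_cast this
  exact (sq_eq_sq₀ (norm_nonneg _) (norm_nonneg _)).mp h2

lemma esp_init {M S : ℕ} (X : Matrix (Fin (M + 1)) (Fin S) ℂ) : ‖rowsInit X‖ ≤ ‖X‖ := by
  refine esp_opNorm_le _ _ (norm_nonneg _) fun x => le_trans ?_ (esp_le X x)
  refine (sq_le_sq₀ (norm_nonneg _) (norm_nonneg _)).mp ?_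
  rw [EuclideanSpace.norm_sq_eq, EuclideanSpace.norm_sq_eq, Fin.sum_univ_castSucc]
  refine le_add_of_le_of_nonneg (le_of_eq ?_) (by positivity)
  rfl

lemma esp_tail {M S : ℕ} (X : Matrix (Fin (M + 1)) (Fin S) ℂ) : ‖rowsTail X‖ ≤ ‖X‖ := by
  refine esp_opNorm_le _ _ (norm_nonneg _) fun x => le_trans ?_ (esp_le X x)
  refine (sq_le_sq₀ (norm_nonneg _) (norm_nonneg _)).mp ?_
  rw [EuclideanSpace.norm_sq_eq, EuclideanSpace.norm_sq_eq, Fin.sum_univ_succ]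
  refine le_add_of_nonneg_of_le (by positivity) (le_of_eq ?_)
  rfl

/-- lower bound on the Gram matrix -/
lemma esp_gram {m n : ℕ} (B : Matrix (Fin m) (Fin n) ℂ) (β : ℝ) (hβ : 0 < β)
    (h : ∀ x, β * ‖x‖ ≤ ‖toEuclideanLin B x‖) (x : EuclideanSpace ℂ (Fin n)) :
    β * ‖toEuclideanLin B x‖ ≤ ‖toEuclideanLin (Bᴴ * B) x‖ := by
  have h1 : inner ℂ x (toEuclideanLin (Bᴴ * B) x) = ((‖toEuclideanLin B x‖ ^ 2 : ℝ) : ℂ) := by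
    rw [esp_mul, ← esp_adj, inner_self_eq_norm_sq_to_K]; simp
  have h2 := norm_inner_le_norm (𝕜 := ℂ) x (toEuclideanLin (Bᴴ * B) x)
  rw [h1, Complex.norm_real, Real.norm_of_nonneg (by positivity)] at h2
  have h3 := h x
  have h4 := norm_nonneg (toEuclideanLin (Bᴴ * B) x)
  have h6 := norm_nonneg x
  rcases (norm_nonneg (toEuclideanLin B x)).eq_or_lt with h5 | h5
  · rw [← h5]; simp
  · refine le_of_mul_le_mul_right ?_ h5
    calc β * ‖toEuclideanLin B x‖ * ‖toEuclideanLin B x‖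
        = β * ‖toEuclideanLin B x‖ ^ 2 := by ring
      _ ≤ β * (‖x‖ * ‖toEuclideanLin (Bᴴ * B) x‖) := by gcongr
      _ = (β * ‖x‖) * ‖toEuclideanLin (Bᴴ * B) x‖ := by ring
      _ ≤ ‖toEuclideanLin B x‖ * ‖toEuclideanLin (Bᴴ * B) x‖ := by gcongr
      _ = _ := by ring

lemma esp_gram_unit {m n : ℕ} (B : Matrix (Fin m) (Fin n) ℂ) (β : ℝ) (hβ : 0 < β)
    (h : ∀ x, β * ‖x‖ ≤ ‖toEuclideanLin B x‖) :
    (Bᴴ * B)⁻¹ * (Bᴴ * B) = 1 ∧ (Bᴴ * B) * (Bᴴ * B)⁻¹ = 1 := by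
  have hu : IsUnit (Bᴴ * B) := by
    rw [← Matrix.mulVec_injective_iff_isUnit]
    refine (injective_iff_map_eq_zero' (Matrix.mulVecLin (Bᴴ * B))).mpr ?_
    intro v
    refine ⟨fun hv => ?_, fun hv => by simp [hv]⟩
    have h1 := esp_gram B β hβ h (WithLp.toLp 2 v)
    have h2 := h (WithLp.toLp 2 v)
    have h3 : toEuclideanLin (Bᴴ * B) (WithLp.toLp 2 v) = 0 := by
      rw [esp_apply]
      rw [Matrix.mulVecLin_apply] at hv
      rw [hv]; rfl
    rw [h3, norm_zero] at h1
    have h4 : ‖toEuclideanLin B (WithLp.toLp 2 v)‖ ≤ 0 := by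
      by_contra hc; push Not at hc; nlinarith
    have h5 : ‖(WithLp.toLp 2 v : EuclideanSpace ℂ (Fin n))‖ ≤ 0 := by
      by_contra hc; push Not at hc; nlinarith
    have h6 := norm_le_zero_iff.mp h5
    simpa using congrArg WithLp.ofLp h6
  have hd := (Matrix.isUnit_iff_isUnit_det _).mp hu
  exact ⟨Matrix.nonsing_inv_mul _ hd, Matrix.mul_nonsing_inv _ hd⟩

lemma esp_gram_inv {m n : ℕ} (B : Matrix (Fin m) (Fin n) ℂ) (β : ℝ) (hβ : 0 < β)
    (h : ∀ x, β * ‖x‖ ≤ ‖toEuclideanLin B x‖) : ‖(Bᴴ * B)⁻¹‖ ≤ 1 / β ^ 2 := by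
  obtain ⟨h1, h2⟩ := esp_gram_unit B β hβ h
  refine esp_opNorm_le _ _ (by positivity) fun y => ?_
  set x := toEuclideanLin (Bᴴ * B)⁻¹ y with hx
  have hy : toEuclideanLin (Bᴴ * B) x = y := by
    rw [hx, ← esp_mul, h2]; simp
  have h3 := esp_gram B β hβ h x
  have h4 := h x
  rw [hy] at h3
  rw [div_mul_eq_mul_div, one_mul, le_div_iff₀ (by positivity)]
  nlinarith

lemma esp_pinv_norm {m n : ℕ} (B : Matrix (Fin m) (Fin n) ℂ) (β : ℝ) (hβ : 0 < β)
    (h : ∀ x, β * ‖x‖ ≤ ‖toEuclideanLin B x‖) : ‖pinv B‖ ≤ 1 / β := by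
  obtain ⟨h1, h2⟩ := esp_gram_unit B β hβ h
  have h3 := esp_gram_inv B β hβ h
  have h4 : (pinv B)ᴴᴴ * (pinv B)ᴴ = (Bᴴ * B)⁻¹ := by
    unfold pinv
    rw [conjTranspose_conjTranspose, conjTranspose_mul, conjTranspose_conjTranspose,
      conjTranspose_nonsing_inv, conjTranspose_mul, conjTranspose_conjTranspose,
      Matrix.mul_assoc, ← Matrix.mul_assoc Bᴴ, h2, Matrix.mul_one]
  have h5 := l2_opNorm_conjTranspose_mul_self (pinv B)ᴴ
  rw [h4, l2_opNorm_conjTranspose] at h5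
  refine (sq_le_sq₀ (norm_nonneg _) (by positivity)).mp ?_
  rw [sq, ← h5, div_pow, one_pow]
  exact h3

lemma esp_pinv_resid {m n : ℕ} (B : Matrix (Fin m) (Fin n) ℂ) (β : ℝ) (hβ : 0 < β)
    (h : ∀ x, β * ‖x‖ ≤ ‖toEuclideanLin B x‖) :
    ‖1 - B * pinv B‖ ≤ 1 ∧ Bᴴ * (1 - B * pinv B) = 0 := by
  obtain ⟨h1, h2⟩ := esp_gram_unit B β hβ h
  have h3 : Bᴴ * (B * pinv B) = Bᴴ := by
    unfold pinv
    rw [← Matrix.mul_assoc, ← Matrix.mul_assoc, h2, Matrix.one_mul]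
  have h4 : (B * pinv B)ᴴ = B * pinv B := by
    unfold pinv
    rw [conjTranspose_mul, conjTranspose_mul, conjTranspose_conjTranspose,
      conjTranspose_nonsing_inv, conjTranspose_mul, conjTranspose_conjTranspose,
      Matrix.mul_assoc]
  have h5 : Bᴴ * (1 - B * pinv B) = 0 := by
    rw [Matrix.mul_sub, h3, Matrix.mul_one, sub_self]
  refine ⟨esp_proj _ ?_ ?_, h5⟩
  · rw [conjTranspose_sub, h4, conjTranspose_one]
  · have : B * pinv B * (1 - B * pinv B) = 0 := by
      unfold pinv at h5 ⊢
      rw [Matrix.mul_assoc B, Matrix.mul_assoc _ Bᴴ, h5]; simp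
    rw [Matrix.sub_mul, this, Matrix.one_mul, sub_zero]

/-- perturbation of the least squares solution -/
lemma esp_lsq {m n k : ℕ} (B Bh : Matrix (Fin m) (Fin n) ℂ) (C Ch : Matrix (Fin m) (Fin k) ℂ)
    (σ δ β : ℝ) (hσ : 0 < σ) (hβ : 0 < β)
    (h : ∀ x, σ * ‖x‖ ≤ ‖toEuclideanLin B x‖) (hh : ∀ x, β * ‖x‖ ≤ ‖toEuclideanLin Bh x‖)
    (hB : ‖Bh - B‖ ≤ δ) (hC : ‖Ch - C‖ ≤ δ) (hC1 : ‖C‖ ≤ 1) :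
    ‖pinv B * C - pinv Bh * Ch‖ ≤ δ / β + δ / (β * σ) + δ / β ^ 2 := by
  have hδ : 0 ≤ δ := (norm_nonneg _).trans hB
  obtain ⟨hr1, hr2⟩ := esp_pinv_resid B σ hσ h
  have hi : pinv Bh * Bh = 1 := by
    unfold pinv; rw [Matrix.mul_assoc]; exact (esp_gram_unit Bh β hβ hh).1
  have hP := esp_pinv_norm Bh β hβ hh
  have hP0 := esp_pinv_norm B σ hσ h
  have hG := esp_gram_inv Bh β hβ hh
  have e3 : pinv Bh * (1 - B * pinv B) = (Bhᴴ * Bh)⁻¹ * ((Bh - B)ᴴ * (1 - B * pinv B)) := by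
    rw [conjTranspose_sub, Matrix.sub_mul _ Bᴴ, hr2, sub_zero]
    conv_lhs => rw [pinv, Matrix.mul_assoc]
  have e : pinv B * C - pinv Bh * Ch = -(pinv Bh * (Ch - C)) +
      pinv Bh * ((Bh - B) * (pinv B * C)) - pinv Bh * (1 - B * pinv B) * C := by
    have : pinv Bh * ((Bh - B) * (pinv B * C)) =
        (pinv Bh * Bh) * (pinv B * C) - pinv Bh * B * pinv B * C := by
      simp only [Matrix.mul_sub, Matrix.sub_mul, Matrix.mul_assoc]
    rw [this, hi]
    simp only [Matrix.mul_sub, Matrix.sub_mul, Matrix.mul_assoc, Matrix.mul_one, Matrix.one_mul]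
    abel
  rw [e]
  refine (norm_sub_le _ _).trans (add_le_add ((norm_add_le _ _).trans (add_le_add ?_ ?_)) ?_)
  · rw [norm_neg]
    refine (l2_opNorm_mul _ _).trans ?_
    calc _ ≤ (1 / β) * δ := by gcongr
      _ = _ := by ring
  · refine (l2_opNorm_mul _ _).trans ?_
    calc _ ≤ (1 / β) * (δ * (1 / σ * 1)) := by
          gcongr
          refine (l2_opNorm_mul _ _).trans ?_
          gcongr
          refine (l2_opNorm_mul _ _).trans ?_
          gcongr
      _ = _ := by field_simp
  · rw [e3]
    refine (l2_opNorm_mul _ _).trans ?_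
    calc _ ≤ (1 / β ^ 2 * (δ * 1)) * 1 := by
          gcongr
          refine (l2_opNorm_mul _ _).trans ?_
          gcongr
          refine (l2_opNorm_mul _ _).trans ?_
          rw [l2_opNorm_conjTranspose]
          gcongr
      _ = _ := by ring

/-- spectral bound on the orthogonal complement of an invariant subspace -/
lemma esp_compl {n : ℕ} {ι : Type*} [Fintype ι] [DecidableEq ι]
    (H : Matrix (Fin n) (Fin n) ℂ) (hH : H.IsHermitian)
    (U : Matrix (Fin n) ι ℂ) (hU : Uᴴ * U = 1) (μ : ι → ℝ)
    (hHU : H * U = U * Matrix.diagonal (fun i => (μ i : ℂ))) (c b : ℝ) (hb : 0 ≤ b)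
    (h : ∀ (ν : ℝ) (v : Fin n → ℂ), v ≠ 0 → H *ᵥ v = (ν : ℂ) • v → Uᴴ *ᵥ v = 0 → |ν - c| ≤ b) :
    H * (1 - U * Uᴴ) = (1 - U * Uᴴ) * H ∧ ‖(H - (c : ℂ) • 1) * (1 - U * Uᴴ)‖ ≤ b := by
  have hc1 : H * (U * Uᴴ) = U * Matrix.diagonal (fun i => (μ i : ℂ)) * Uᴴ := by
    rw [← Matrix.mul_assoc, hHU]
  have hD : (Matrix.diagonal (fun i => (μ i : ℂ)))ᴴ = Matrix.diagonal (fun i => (μ i : ℂ)) := by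
    rw [Matrix.diagonal_conjTranspose]
    congr 1
    ext i
    simp
  have hc2 : (U * Uᴴ) * H = U * Matrix.diagonal (fun i => (μ i : ℂ)) * Uᴴ := by
    have := congrArg conjTranspose hc1
    rw [conjTranspose_mul, conjTranspose_mul, conjTranspose_mul, conjTranspose_mul,
      conjTranspose_conjTranspose, hH.eq, hD] at this
    rw [this, Matrix.mul_assoc]
  have hcomm : H * (1 - U * Uᴴ) = (1 - U * Uᴴ) * H := by
    rw [Matrix.mul_sub, Matrix.sub_mul, hc1, hc2, Matrix.mul_one, Matrix.one_mul]
  refine ⟨hcomm, ?_⟩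
  set Q := 1 - U * Uᴴ with hQ
  have hQh : Qᴴ = Q := by
    rw [hQ, conjTranspose_sub, conjTranspose_mul, conjTranspose_conjTranspose, conjTranspose_one]
  have hUQ : Uᴴ * Q = 0 := by
    rw [hQ, Matrix.mul_sub, ← Matrix.mul_assoc, hU, Matrix.mul_one, Matrix.one_mul, sub_self]
  have hcomm2 : (H - (c : ℂ) • 1) * Q = Q * (H - (c : ℂ) • 1) := by
    rw [Matrix.sub_mul, Matrix.mul_sub Q, hcomm]
    simp
  refine esp_herm_bound _ ?_ b hb ?_
  · unfold Matrix.IsHermitian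
    rw [conjTranspose_mul, hQh, conjTranspose_sub, hH.eq, conjTranspose_smul, conjTranspose_one,
      hcomm2]
    simp
  · intro η w hw0 hw
    rcases eq_or_ne η 0 with h0 | h0
    · simpa [h0] using hb
    have hw' : ((H - (c : ℂ) • 1) * Q) *ᵥ WithLp.ofLp w = (η : ℂ) • WithLp.ofLp w :=
      congrArg WithLp.ofLp hw
    have hη : (η : ℂ) ≠ 0 := by exact_mod_cast h0
    have hUw : Uᴴ *ᵥ WithLp.ofLp w = 0 := by
      have h1 : Uᴴ *ᵥ ((η : ℂ) • WithLp.ofLp w) = 0 := by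
        rw [← hw', Matrix.mulVec_mulVec, hcomm2, ← Matrix.mul_assoc, hUQ]; simp
      rw [Matrix.mulVec_smul] at h1
      exact (smul_eq_zero.mp h1).resolve_left hη
    have hQw : Q *ᵥ WithLp.ofLp w = WithLp.ofLp w := by
      rw [hQ, Matrix.sub_mulVec, ← Matrix.mulVec_mulVec, hUw]; simp
    have hHw : H *ᵥ WithLp.ofLp w = ((η + c : ℝ) : ℂ) • WithLp.ofLp w := by
      rw [← Matrix.mulVec_mulVec, hQw, Matrix.sub_mulVec, Matrix.smul_mulVec, Matrix.one_mulVec,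
        sub_eq_iff_eq_add] at hw'
      rw [hw']; push_cast; rw [add_smul]
    have := h (η + c) (WithLp.ofLp w) (by simpa using hw0) hHw hUw
    simpa using this

lemma esp_diag_inner {n : ℕ} (d : Fin n → ℝ) (c : EuclideanSpace ℂ (Fin n)) :
    inner ℂ c (toEuclideanLin (Matrix.diagonal (fun i => (d i : ℂ))) c) =
      ((∑ i, d i * ‖c i‖ ^ 2 : ℝ) : ℂ) := by
  rw [PiLp.inner_apply]
  push_cast
  refine Finset.sum_congr rfl fun i _ => ?_
  rw [esp_apply]
  simp only [mulVec_diagonal, RCLike.inner_apply]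
  rw [mul_assoc, Complex.mul_conj, Complex.normSq_eq_norm_sq]
  push_cast
  rfl

lemma esp_psd {m n : ℕ} (A : Matrix (Fin m) (Fin n) ℂ) (p : Fin n → ℝ) (hp : ∀ i, 0 < p i)
    (x : EuclideanSpace ℂ (Fin m)) :
    0 ≤ (inner ℂ x (toEuclideanLin (A * Matrix.diagonal (fun i => (p i : ℂ)) * Aᴴ) x)).re := by
  have h := esp_adj Aᴴ x (toEuclideanLin (Matrix.diagonal (fun i => (p i : ℂ)))
    (toEuclideanLin Aᴴ x))
  rw [conjTranspose_conjTranspose] at h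
  rw [esp_mul, esp_mul, ← h, esp_diag_inner, Complex.ofReal_re]
  exact Finset.sum_nonneg fun i _ => mul_nonneg (hp i).le (by positivity)

lemma esp_weyl {N S : ℕ} (A : Matrix (Fin N) (Fin S) ℂ) (p : Fin S → ℝ) (hp : ∀ i, 0 < p i)
    (σsq : ℝ) (That E : Matrix (Fin N) (Fin N) ℂ)
    (hE : That = A * Matrix.diagonal (fun i => (p i : ℂ)) * Aᴴ + (σsq : ℂ) • 1 - E)
    (Uh : Matrix (Fin N) (Fin S) ℂ) (hUh : IsTopEigenbasis That Uh)
    (ν : ℝ) (v : Fin N → ℂ) (hv : v ≠ 0) (hev : That *ᵥ v = (ν : ℂ) • v) (hUv : Uhᴴ *ᵥ v = 0) :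
    |ν - σsq| ≤ ‖E‖ := by
  obtain ⟨hU1, μ, hμ, htop⟩ := hUh
  have hνμ := htop ν v hv hev hUv
  set v' : EuclideanSpace ℂ (Fin N) := WithLp.toLp 2 v with hv'
  have hv0 : v' ≠ 0 := fun h => hv (by simpa [hv'] using congrArg WithLp.ofLp h)
  have hev' : toEuclideanLin That v' = (ν : ℂ) • v' := by
    rw [esp_apply, hv']; simp [hev]
  have hUv' : toEuclideanLin Uhᴴ v' = 0 := by
    rw [esp_apply, hv']; simp [hUv]
  set B := A * Matrix.diagonal (fun i => (p i : ℂ)) * Aᴴ with hB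
  have hTw : ∀ w, toEuclideanLin That w = toEuclideanLin B w + (σsq : ℂ) • w
      - toEuclideanLin E w := by
    intro w
    rw [hE, map_sub, map_add, map_smul]; simp
  have hEw : ∀ w : EuclideanSpace ℂ (Fin N),
      |(inner ℂ w (toEuclideanLin E w)).re| ≤ ‖E‖ * ‖w‖ ^ 2 := by
    intro w
    refine (Complex.abs_re_le_norm _).trans ((norm_inner_le_norm _ _).trans ?_)
    have := esp_le E w
    nlinarith [norm_nonneg w]
  have hself : ∀ (w : EuclideanSpace ℂ (Fin N)) (r : ℝ),
      (inner ℂ w ((r : ℂ) • w)).re = r * ‖w‖ ^ 2 := by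
    intro w r
    rw [inner_smul_right, inner_self_eq_norm_sq_to_K, Complex.re_ofReal_mul]
    congr 1
    norm_cast
  have hquad : ∀ w, (inner ℂ w (toEuclideanLin That w)).re =
      (inner ℂ w (toEuclideanLin B w)).re + σsq * ‖w‖ ^ 2 -
        (inner ℂ w (toEuclideanLin E w)).re := by
    intro w
    rw [hTw, inner_sub_right, inner_add_right, Complex.sub_re, Complex.add_re, hself]
  have hvpos : 0 < ‖v'‖ ^ 2 := by positivity
  rw [abs_le]
  constructor
  · have h1 := hquad v'
    rw [hev', hself] at h1
    have h2 := esp_psd A p hp v'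
    rw [← hB] at h2
    have h3 := (abs_le.mp (hEw v')).2
    have h4 : 0 ≤ (ν - σsq + ‖E‖) * ‖v'‖ ^ 2 := by linarith
    have := nonneg_of_mul_nonneg_left h4 hvpos
    linarith
  · let F : (EuclideanSpace ℂ (Fin S) × ℂ) →ₗ[ℂ] EuclideanSpace ℂ (Fin S) :=
      (toEuclideanLin Aᴴ).comp ((toEuclideanLin Uh).coprod (LinearMap.toSpanSingleton ℂ _ v'))
    have hker : LinearMap.ker F ≠ ⊥ := F.ker_ne_bot_of_finrank_lt (by simp)
    obtain ⟨⟨c, d⟩, hcd, hne⟩ := (Submodule.ne_bot_iff _).mp hker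
    set w := toEuclideanLin Uh c + d • v' with hw
    have hAw : toEuclideanLin Aᴴ w = 0 := hcd
    have hBw : toEuclideanLin B w = 0 := by
      rw [hB, esp_mul, hAw, map_zero]
    have hx : ∀ x, inner ℂ (toEuclideanLin Uh x) v' = 0 := by
      intro x; rw [esp_adj, hUv', inner_zero_right]
    have hx' : ∀ x, inner ℂ v' (toEuclideanLin Uh x) = 0 := fun x =>
      inner_eq_zero_symm.mp (hx x)
    have hUU : ∀ x y, inner ℂ (toEuclideanLin Uh x) (toEuclideanLin Uh y) = inner ℂ x y := by
      intro x y
      rw [esp_adj, ← esp_mul, hU1]; simp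
    have hThw : toEuclideanLin That w = toEuclideanLin Uh
        (toEuclideanLin (Matrix.diagonal (fun i => (μ i : ℂ))) c) + (d * ν) • v' := by
      rw [hw, map_add, map_smul, ← esp_mul, hμ, hev', esp_mul, smul_smul]
    have hq : (inner ℂ w (toEuclideanLin That w)).re =
        (∑ i, μ i * ‖c i‖ ^ 2) + ν * (‖d‖ ^ 2 * ‖v'‖ ^ 2) := by
      rw [hThw, hw]
      simp only [inner_add_left, inner_add_right, inner_smul_left, inner_smul_right, hx, hx', hUU,
        esp_diag_inner, mul_zero, add_zero, zero_add]
      rw [Complex.add_re, Complex.ofReal_re, inner_self_eq_norm_sq_to_K]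
      congr 1
      have : d * ν * ((starRingEnd ℂ) d * ((‖v'‖ : ℂ)) ^ 2) =
        ((ν * (‖d‖ ^ 2 * ‖v'‖ ^ 2) : ℝ) : ℂ) := by
        have := Complex.mul_conj' d
        push_cast
        linear_combination (ν * (‖v'‖ : ℂ) ^ 2) * this
      exact (congrArg Complex.re this).trans (Complex.ofReal_re _)
    have hn : ‖w‖ ^ 2 = (∑ i, ‖c i‖ ^ 2) + ‖d‖ ^ 2 * ‖v'‖ ^ 2 := by
      rw [← EuclideanSpace.norm_sq_eq]
      have := norm_add_sq_eq_norm_sq_add_norm_sq_of_inner_eq_zero (𝕜 := ℂ)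
        (toEuclideanLin Uh c) (d • v') (by rw [inner_smul_right, hx, mul_zero])
      rw [← sq, ← sq, ← sq, ← hw, esp_isom_norm Uh hU1, norm_smul, mul_pow] at this
      exact this
    have hge : ν * ‖w‖ ^ 2 ≤ (inner ℂ w (toEuclideanLin That w)).re := by
      rw [hq, hn, mul_add, Finset.mul_sum]
      gcongr with i
      exact hνμ i
    have hle := hquad w
    rw [hBw, inner_zero_right, Complex.zero_re, zero_add] at hle
    have h3 := (abs_le.mp (hEw w)).1
    have hwpos : 0 < ‖w‖ ^ 2 := by
      rw [hn, ← EuclideanSpace.norm_sq_eq]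
      rcases eq_or_ne d 0 with hd | hd
      · have : c ≠ 0 := fun hc => hne (by rw [hc, hd]; rfl)
        positivity
      · positivity
    have h4 : (ν - σsq) * ‖w‖ ^ 2 ≤ ‖E‖ * ‖w‖ ^ 2 := by linarith
    exact le_of_mul_le_mul_right h4 hwpos

lemma esp_sval_mem_le {m n : ℕ} (A : Matrix (Fin m) (Fin n) ℂ) (k : ℕ) (hk : 1 ≤ k) (r : ℝ)
    (V : Submodule ℂ (EuclideanSpace ℂ (Fin n))) (hV : Module.finrank ℂ V = k)
    (h : ∀ x ∈ V, r * ‖x‖ ≤ ‖toEuclideanLin A x‖) : r ≤ ‖A‖ := by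
  have : V ≠ ⊥ := by
    rintro rfl
    simp at hV
    omega
  obtain ⟨x, hx, hx0⟩ := (Submodule.ne_bot_iff _).mp this
  exact le_of_mul_le_mul_right ((h x hx).trans (esp_le A x)) (by positivity)

lemma esp_sval_bdd {m n : ℕ} (A : Matrix (Fin m) (Fin n) ℂ) (k : ℕ) (hk : 1 ≤ k) :
    BddAbove {r : ℝ | 0 ≤ r ∧ ∃ V : Submodule ℂ (EuclideanSpace ℂ (Fin n)),
    Module.finrank ℂ V = k ∧ ∀ x ∈ V, r * ‖x‖ ≤ ‖Matrix.toEuclideanLin A x‖} := by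
  refine ⟨‖A‖, ?_⟩
  rintro r ⟨_, V, hV, h⟩
  exact esp_sval_mem_le A k hk r V hV h

lemma esp_sval_nonneg {m n : ℕ} (A : Matrix (Fin m) (Fin n) ℂ) (k : ℕ) : 0 ≤ sval A k :=
  Real.sSup_nonneg fun _ h => h.1

lemma esp_sval_full {m n : ℕ} (A : Matrix (Fin m) (Fin n) ℂ) (x : EuclideanSpace ℂ (Fin n)) :
    sval A n * ‖x‖ ≤ ‖toEuclideanLin A x‖ := by
  rcases eq_or_ne x 0 with rfl | hx
  · simp
  have hx : 0 < ‖x‖ := by positivity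
  rw [← le_div_iff₀ hx]
  refine Real.sSup_le ?_ (by positivity)
  rintro r ⟨_, V, hV, h⟩
  rw [le_div_iff₀ hx]
  have : V = ⊤ := Submodule.eq_top_of_finrank_eq (by rw [hV]; simp)
  exact h x (this ▸ Submodule.mem_top)

lemma esp_sval_gram {m n : ℕ} (hn : 1 ≤ n) (A : Matrix (Fin m) (Fin n) ℂ) (p : Fin n → ℝ)
    (q : ℝ) (hq : 0 ≤ q) (hp : ∀ i, q ≤ p i) (ha : 0 < sval A n) :
    q * sval A n ^ 2 ≤ sval (A * Matrix.diagonal (fun i => (p i : ℂ)) * Aᴴ) n := by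
  have hA := esp_sval_full A
  refine le_csSup (esp_sval_bdd _ n hn) ⟨by positivity, LinearMap.range (toEuclideanLin A), ?_, ?_⟩
  · rw [LinearMap.finrank_range_of_inj]
    · simp
    · refine (injective_iff_map_eq_zero (toEuclideanLin A)).mpr fun x hx => ?_
      have := hA x
      rw [hx, norm_zero] at this
      have h5 : ‖x‖ ≤ 0 := by
        by_contra hc; push Not at hc; nlinarith
      exact norm_le_zero_iff.mp h5
  · rintro _ ⟨y, rfl⟩
    have h1 := esp_gram A _ ha hA y
    rw [esp_mul] at h1
    set x := toEuclideanLin A y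
    rw [esp_mul, esp_mul]
    set w := toEuclideanLin Aᴴ x
    have h2 := hA (toEuclideanLin (Matrix.diagonal (fun i => (p i : ℂ))) w)
    have h3 : q * ‖w‖ ≤ ‖toEuclideanLin (Matrix.diagonal (fun i => (p i : ℂ))) w‖ := by
      refine (sq_le_sq₀ (by positivity) (norm_nonneg _)).mp ?_
      rw [mul_pow, EuclideanSpace.norm_sq_eq, EuclideanSpace.norm_sq_eq, Finset.mul_sum]
      refine Finset.sum_le_sum fun i _ => ?_
      rw [esp_apply]
      simp only [mulVec_diagonal, norm_mul, mul_pow]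
      have : q ≤ ‖(p i : ℂ)‖ := by
        rw [Complex.norm_real]; exact (hp i).trans (le_abs_self _)
      gcongr
    calc q * sval A n ^ 2 * ‖x‖ = sval A n * (q * (sval A n * ‖x‖)) := by ring
      _ ≤ sval A n * (q * ‖w‖) := by gcongr
      _ ≤ sval A n * ‖toEuclideanLin (Matrix.diagonal (fun i => (p i : ℂ))) w‖ := by gcongr
      _ ≤ _ := h2

lemma esp_sval_le_eig {N S : ℕ} (B : Matrix (Fin N) (Fin N) ℂ) (hB : B.IsHermitian)
    (hpos : ∀ x, 0 ≤ (inner ℂ x (toEuclideanLin B x)).re)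
    (U : Matrix (Fin N) (Fin S) ℂ) (hU : Uᴴ * U = 1) (κ : Fin S → ℝ)
    (hBU : B * U = U * Matrix.diagonal (fun i => (κ i : ℂ)))
    (htop : ∀ (ν : ℝ) (v : Fin N → ℂ), v ≠ 0 → B *ᵥ v = (ν : ℂ) • v →
      Uᴴ *ᵥ v = 0 → ∀ i, ν ≤ κ i) (i : Fin S) : sval B S ≤ κ i := by
  have hself : ∀ (w : EuclideanSpace ℂ (Fin N)) (r : ℝ),
      (inner ℂ w ((r : ℂ) • w)).re = r * ‖w‖ ^ 2 := by
    intro w r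
    rw [inner_smul_right, inner_self_eq_norm_sq_to_K, Complex.re_ofReal_mul]
    congr 1
    norm_cast
  have heig : ∀ (ν : ℝ) (v : EuclideanSpace ℂ (Fin N)), v ≠ 0 →
      toEuclideanLin B v = (ν : ℂ) • v → 0 ≤ ν := by
    intro ν v hv h
    have h1 := hpos v
    rw [h, hself] at h1
    exact nonneg_of_mul_nonneg_left h1 (by positivity)
  have hκ : 0 ≤ κ i := by
    refine heig (κ i) (toEuclideanLin U (EuclideanSpace.single i 1)) ?_ ?_
    · rw [← norm_ne_zero_iff, esp_isom_norm U hU]; simp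
    · rw [← esp_mul, hBU, esp_mul, ← map_smul]
      congr 1
      rw [esp_apply]
      ext j
      simp [mulVec_diagonal, Pi.single_apply]
      split_ifs with hj
      · rw [hj]
      · rfl
  let ι := {j : Fin S // j ≠ i}
  let U' : Matrix (Fin N) ι ℂ := U.submatrix id Subtype.val
  have hU'app : ∀ (v : Fin N → ℂ) (j : ι), (U'ᴴ *ᵥ v) j = (Uᴴ *ᵥ v) j.1 := fun v j => rfl
  have hU' : U'ᴴ * U' = 1 := by
    ext a b
    have := congrFun (congrFun hU a.1) b.1
    rw [Matrix.one_apply] at this ⊢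
    exact Eq.trans this (if_congr Subtype.ext_iff.symm rfl rfl)
  have hBU' : B * U' = U' * Matrix.diagonal (fun j : ι => (κ j.1 : ℂ)) := by
    ext a b
    have := congrFun (congrFun hBU a) b.1
    rw [Matrix.mul_diagonal] at this ⊢
    exact this
  obtain ⟨-, hn⟩ := esp_compl B hB U' hU' (fun j => κ j.1) hBU' 0 (κ i) hκ (by
    intro ν v hv hBv hUv
    have h0 : 0 ≤ ν := heig ν (WithLp.toLp 2 v)
      (fun h => hv (by simpa using congrArg WithLp.ofLp h)) (by rw [esp_apply]; simp [hBv])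
    rw [sub_zero, abs_of_nonneg h0]
    by_cases hi : (Uᴴ *ᵥ v) i = 0
    · refine htop ν v hv hBv ?_ i
      ext j
      by_cases hj : j = i
      · rw [hj, hi]; rfl
      · exact congrFun hUv ⟨j, hj⟩
    · have h1 : Uᴴ * B = Matrix.diagonal (fun i => (κ i : ℂ)) * Uᴴ := by
        have := congrArg conjTranspose hBU
        rw [conjTranspose_mul, conjTranspose_mul, hB.eq, Matrix.diagonal_conjTranspose] at this
        rw [this]
        congr 2
        ext j
        simp
      have h2 : Uᴴ *ᵥ (B *ᵥ v) = Matrix.diagonal (fun i => (κ i : ℂ)) *ᵥ (Uᴴ *ᵥ v) := by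
        rw [Matrix.mulVec_mulVec, h1, ← Matrix.mulVec_mulVec]
      rw [hBv, Matrix.mulVec_smul] at h2
      have h3 := congrFun h2 i
      rw [mulVec_diagonal, Pi.smul_apply, smul_eq_mul] at h3
      have h4 := mul_right_cancel₀ hi h3
      exact le_of_eq (by exact_mod_cast h4))
  refine Real.sSup_le ?_ hκ
  rintro r ⟨_, V, hV, h⟩
  let F : V →ₗ[ℂ] (ι → ℂ) := (Matrix.mulVecLin U'ᴴ).comp
    ((WithLp.linearEquiv 2 ℂ (Fin N → ℂ)).toLinearMap.comp V.subtype)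
  have hker : LinearMap.ker F ≠ ⊥ := F.ker_ne_bot_of_finrank_lt (by
    rw [hV]
    simp only [Module.finrank_fintype_fun_eq_card, ι]
    rw [Fintype.card_subtype_compl]
    simp
    exact i.pos)
  obtain ⟨⟨x, hxV⟩, hx, hne⟩ := (Submodule.ne_bot_iff _).mp hker
  have hx0 : x ≠ 0 := fun h => hne (by simp [h])
  have hUx : U'ᴴ *ᵥ WithLp.ofLp x = 0 := hx
  have hQx : toEuclideanLin ((B - ((0 : ℝ) : ℂ) • 1) * (1 - U' * U'ᴴ)) x =
      toEuclideanLin B x := by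
    rw [esp_apply, esp_apply, ← Matrix.mulVec_mulVec, Matrix.sub_mulVec 1,
      ← Matrix.mulVec_mulVec (WithLp.ofLp x) U', hUx]
    simp
  have h1 := esp_le ((B - ((0 : ℝ) : ℂ) • 1) * (1 - U' * U'ᴴ)) x
  rw [hQx] at h1
  have h2 := h x hxV
  refine le_of_mul_le_mul_right (h2.trans (h1.trans ?_)) (by positivity : 0 < ‖x‖)
  gcongr

/-- Davis–Kahan type estimate -/
lemma esp_dk {N S : ℕ} (T That E : Matrix (Fin N) (Fin N) ℂ) (hE : E = T - That)
    (U : Matrix (Fin N) (Fin S) ℂ) (hU : ‖U‖ ≤ 1) (Q : Matrix (Fin N) (Fin N) ℂ)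
    (hQ1 : Qᴴ = Q) (hQ2 : Q * Q = Q) (σsq κ : ℝ) (hκ : 0 < κ)
    (hcomm : That * Q = Q * That) (hG : ‖(That - (σsq : ℂ) • 1) * Q‖ ≤ ‖E‖)
    (μ : Fin S → ℝ) (hTU : T * U = U * Matrix.diagonal (fun i => (μ i : ℂ)))
    (hμ : ∀ i, κ ≤ μ i - σsq) : κ * ‖Q * U‖ ≤ ‖E‖ + ‖E‖ * ‖Q * U‖ := by
  have hQn := esp_proj Q hQ1 hQ2
  have hpos : ∀ i, 0 < μ i - σsq := fun i => hκ.trans_le (hμ i)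
  set D : Matrix (Fin S) (Fin S) ℂ := Matrix.diagonal (fun i => ((μ i - σsq : ℝ) : ℂ)) with hD
  set D' : Matrix (Fin S) (Fin S) ℂ := Matrix.diagonal (fun i => (((μ i - σsq)⁻¹ : ℝ) : ℂ)) with hD'
  have hDD : D * D' = 1 := by
    rw [hD, hD', Matrix.diagonal_mul_diagonal, ← Matrix.diagonal_one]
    congr 1
    ext i
    rw [← Complex.ofReal_mul, mul_inv_cancel₀ (hpos i).ne']
    simp
  have hDn : ‖D'‖ ≤ κ⁻¹ := by
    rw [hD', l2_opNorm_diagonal, pi_norm_le_iff_of_nonneg (by positivity)]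
    intro i
    rw [Complex.norm_real, Real.norm_of_nonneg (inv_nonneg.mpr (hpos i).le)]
    exact inv_anti₀ hκ (hμ i)
  have hUD : U * D = T * U - (σsq : ℂ) • U := by
    rw [hTU]
    ext a b
    rw [hD, Matrix.sub_apply, Matrix.smul_apply, Matrix.mul_diagonal, Matrix.mul_diagonal]
    push_cast
    rw [smul_eq_mul]
    ring
  have e : Q * U * D = Q * (E * U) + (That - (σsq : ℂ) • 1) * Q * (Q * U) := by
    have h1 : (That - (σsq : ℂ) • 1) * Q * (Q * U) = Q * (That * U) - (σsq : ℂ) • (Q * U) := by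
      rw [Matrix.mul_assoc, ← Matrix.mul_assoc Q Q, hQ2, Matrix.sub_mul, ← Matrix.mul_assoc That,
        hcomm, Matrix.mul_assoc Q That]
      simp
    rw [h1, Matrix.mul_assoc, hUD, hE, Matrix.sub_mul, Matrix.mul_sub, Matrix.mul_sub,
      Matrix.mul_smul]
    abel
  have h2 : ‖Q * U * D‖ ≤ ‖E‖ + ‖E‖ * ‖Q * U‖ := by
    rw [e]
    refine (norm_add_le _ _).trans (add_le_add ?_ ?_)
    · calc _ ≤ ‖Q‖ * (‖E‖ * ‖U‖) := (l2_opNorm_mul _ _).trans (by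
            gcongr
            exact l2_opNorm_mul _ _)
        _ ≤ 1 * (‖E‖ * 1) := by gcongr
        _ = _ := by ring
    · refine (l2_opNorm_mul _ _).trans ?_
      gcongr
  have h3 : ‖Q * U‖ ≤ ‖Q * U * D‖ * κ⁻¹ := by
    calc ‖Q * U‖ = ‖Q * U * D * D'‖ := by rw [Matrix.mul_assoc _ D, hDD, Matrix.mul_one]
      _ ≤ ‖Q * U * D‖ * ‖D'‖ := l2_opNorm_mul _ _
      _ ≤ _ := by gcongr
  rw [← div_eq_mul_inv, le_div_iff₀ hκ] at h3
  linarith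

lemma esp_canon {N S : ℕ} (U V : Matrix (Fin N) (Fin S) ℂ) (hU : Uᴴ * U = 1) (hV : Vᴴ * V = 1)
    (s : Fin S → ℝ) (hs : ∀ i, 0 ≤ s i)
    (hUV : Uᴴ * V = Matrix.diagonal (fun i => (s i : ℂ))) :
    ‖V - U‖ ≤ √2 * ‖(1 - V * Vᴴ) * U‖ := by
  have hVU : Vᴴ * U = Matrix.diagonal (fun i => (s i : ℂ)) := by
    have := congrArg conjTranspose hUV
    rw [conjTranspose_mul, conjTranspose_conjTranspose, Matrix.diagonal_conjTranspose] at this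
    rw [this]
    congr 1
    ext i
    simp
  set Q := 1 - V * Vᴴ with hQ
  have hQh : Qᴴ = Q := by
    rw [hQ, conjTranspose_sub, conjTranspose_mul, conjTranspose_conjTranspose, conjTranspose_one]
  have hQQ : Q * Q = Q := by
    have : Q * V = 0 := by
      rw [hQ, Matrix.sub_mul, Matrix.mul_assoc, hV, Matrix.mul_one, Matrix.one_mul, sub_self]
    conv_lhs => rw [hQ]; rw [← hQ]; rw [Matrix.mul_sub, ← Matrix.mul_assoc, this]
    simp
  have e1 : (Q * U)ᴴ * (Q * U) = Matrix.diagonal (fun i => ((1 - s i ^ 2 : ℝ) : ℂ)) := by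
    rw [conjTranspose_mul, hQh, Matrix.mul_assoc, ← Matrix.mul_assoc Q, hQQ, hQ, Matrix.sub_mul,
      Matrix.mul_sub, Matrix.one_mul, hU, Matrix.mul_assoc, hVU, ← Matrix.mul_assoc, hUV,
      Matrix.diagonal_mul_diagonal, ← Matrix.diagonal_one, Matrix.diagonal_sub]
    congr 1
    ext i
    push_cast
    ring
  have e2 : (V - U)ᴴ * (V - U) = Matrix.diagonal (fun i => ((2 * (1 - s i) : ℝ) : ℂ)) := by
    rw [conjTranspose_sub, Matrix.sub_mul, Matrix.mul_sub, Matrix.mul_sub, hU, hV, hUV, hVU,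
      ← Matrix.diagonal_one, Matrix.diagonal_sub, Matrix.diagonal_sub, Matrix.diagonal_sub]
    congr 1
    ext i
    push_cast
    ring
  have hs1 : ∀ i, s i ≤ 1 := by
    intro i
    have h1 : ‖Uᴴ * V‖ ≤ 1 := by
      refine (l2_opNorm_mul _ _).trans ?_
      rw [l2_opNorm_conjTranspose]
      exact mul_le_one₀ (esp_isom U hU) (norm_nonneg _) (esp_isom V hV)
    rw [hUV, l2_opNorm_diagonal] at h1
    have h2 := (norm_le_pi_norm (fun i => (s i : ℂ)) i).trans h1
    rw [Complex.norm_real] at h2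
    exact (le_abs_self _).trans h2
  have n1 := l2_opNorm_conjTranspose_mul_self (Q * U)
  have n2 := l2_opNorm_conjTranspose_mul_self (V - U)
  rw [e1, l2_opNorm_diagonal] at n1
  rw [e2, l2_opNorm_diagonal] at n2
  have h1 : ∀ i, 1 - s i ^ 2 ≤ ‖Q * U‖ * ‖Q * U‖ := by
    intro i
    rw [← n1]
    have h2 := norm_le_pi_norm (fun i => ((1 - s i ^ 2 : ℝ) : ℂ)) i
    rw [Complex.norm_real] at h2
    exact (le_abs_self _).trans h2
  refine (sq_le_sq₀ (norm_nonneg _) (by positivity)).mp ?_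
  rw [mul_pow, Real.sq_sqrt (by norm_num), sq, sq, ← n2,
    pi_norm_le_iff_of_nonneg (by positivity)]
  intro i
  have := hs1 i
  rw [Complex.norm_real, Real.norm_of_nonneg (by linarith)]
  nlinarith [h1 i, hs i]

end EspritHelpers

set_option maxHeartbeats 2000000 in
open scoped Matrix.Norms.L2Operator in

/-- **Perturbation bound for the canonical ESPRIT matrices** (Lemma 9): with canonical
bases `U^c = UL`, `Û^c = ÛR` obtained from an SVD `UᴴÛ = L Σ_c Rᴴ`, if
`p_min σ_S(A)² > σ²` and `‖E‖₂ ≤ σ_S(U₀^c)(σ_S(APAᴴ) − σ²)/(4√2)`, then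
`‖Ψ^c − Ψ̂^c‖₂ ≤ 14√2‖E‖₂/(σ_S(U₀^c)²(p_min σ_S(A)² − σ²))`. -/
theorem canonical_esprit_perturbation_bound {M S : ℕ} (hS : 1 ≤ S) (hSM : S ≤ M)
    (ω : Fin S → ℝ) (hω01 : ∀ i, ω i ∈ Set.Ico (0 : ℝ) 1) (hinj : Function.Injective ω)
    (p : Fin S → ℝ) (hp : ∀ i, 0 < p i) (σsq : ℝ) (hσ : 0 ≤ σsq)
    (That : Matrix (Fin (M + 1)) (Fin (M + 1)) ℂ) (hThat : That.IsHermitian) :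
    let A := vandermonde (M + 1) S ω
    let T := A * Matrix.diagonal (fun i => (p i : ℂ)) * Aᴴ + (σsq : ℂ) • 1
    let E := T - That
    σsq < (⨅ i, p i) * sval A S ^ 2 →
    ∀ U Uh : Matrix (Fin (M + 1)) (Fin S) ℂ,
      IsTopEigenbasis T U → IsTopEigenbasis That Uh →
    ∀ (Lm Rm : Matrix (Fin S) (Fin S) ℂ) (s : Fin S → ℝ),
      Lm ∈ Matrix.unitaryGroup (Fin S) ℂ → Rm ∈ Matrix.unitaryGroup (Fin S) ℂ →
      (∀ i, 0 ≤ s i) → (∀ i j : Fin S, i ≤ j → s j ≤ s i) →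
      Uᴴ * Uh = Lm * Matrix.diagonal (fun i => (s i : ℂ)) * Rmᴴ →
      specNorm E ≤ sval (rowsInit (U * Lm)) S *
          (sval (A * Matrix.diagonal (fun i => (p i : ℂ)) * Aᴴ) S - σsq) /
          (4 * Real.sqrt 2) →
      specNorm (espritMat (U * Lm) - espritMat (Uh * Rm)) ≤
        14 * Real.sqrt 2 * specNorm E /
          (sval (rowsInit (U * Lm)) S ^ 2 * ((⨅ i, p i) * sval A S ^ 2 - σsq)) := by
  intro A T E hgap U Uh hU hUh Lm Rm s hL hR hs _ hsvd hEb
  have hTdef : T = A * Matrix.diagonal (fun i => (p i : ℂ)) * Aᴴ + (σsq : ℂ) • 1 := rfl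
  have hEdef : E = T - That := rfl
  clear_value E T A
  rw [esp_specNorm] at hEb
  rw [esp_specNorm, esp_specNorm]
  set B := A * Matrix.diagonal (fun i => (p i : ℂ)) * Aᴴ with hB
  set g := sval B S with hg
  set q := ⨅ i, p i with hq
  set a := sval A S with ha
  set σ0 := sval (rowsInit (U * Lm)) S with hσ0
  have : Nonempty (Fin S) := ⟨⟨0, hS⟩⟩
  have hqpos : 0 < q := by
    obtain ⟨i, hi⟩ := exists_eq_ciInf_of_finite (f := p)
    rw [hq, ← hi]; exact hp i
  have hqle : ∀ i, q ≤ p i := fun i => ciInf_le (Set.finite_range p).bddBelow i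
  have ha0 : 0 ≤ a := esp_sval_nonneg A S
  have hapos : 0 < a := by
    rcases ha0.eq_or_lt with h | h
    · rw [← h] at hgap
      norm_num at hgap
      linarith
    · exact h
  have hga : q * a ^ 2 ≤ g := esp_sval_gram hS A p q hqpos.le hqle hapos
  have hgpos : 0 < g := by linarith
  have hBh : B.IsHermitian := by
    unfold Matrix.IsHermitian
    rw [hB, conjTranspose_mul, conjTranspose_mul, conjTranspose_conjTranspose,
      Matrix.diagonal_conjTranspose, Matrix.mul_assoc]
    congr 3
    ext i
    simp
  obtain ⟨hU1, μ, hTU, htop⟩ := hU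
  have hκ : ∀ i, g ≤ μ i - σsq := by
    intro i
    refine esp_sval_le_eig B hBh (esp_psd A p hp) U hU1 (fun i => μ i - σsq) ?_ ?_ i
    · have h1 : B * U = T * U - (σsq : ℂ) • U := by rw [hTdef, Matrix.add_mul]; simp
      rw [h1, hTU]
      ext k l
      rw [Matrix.sub_apply, Matrix.smul_apply, Matrix.mul_diagonal, Matrix.mul_diagonal]
      push_cast
      rw [smul_eq_mul]
      ring
    · intro ν v hv hBv hUv j
      have := htop (ν + σsq) v hv (by
        rw [hTdef, Matrix.add_mulVec, hBv, Matrix.smul_mulVec, Matrix.one_mulVec]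
        push_cast
        rw [add_smul]) hUv j
      linarith
  have hUhT := hUh
  obtain ⟨hV1, μh, hThU, htoph⟩ := hUh
  obtain ⟨hcomm, hG⟩ := esp_compl That hThat Uh hV1 μh hThU σsq (specNorm E)
    (norm_nonneg _) (fun ν v hv hev hUv => esp_weyl A p hp σsq That E
      (by rw [hEdef, hTdef]; abel) Uh hUhT ν v hv hev hUv)
  rw [esp_specNorm] at hG
  set Q := 1 - Uh * Uhᴴ with hQ
  have hQh : Qᴴ = Q := by
    rw [hQ, conjTranspose_sub, conjTranspose_mul, conjTranspose_conjTranspose, conjTranspose_one]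
  have hQQ : Q * Q = Q := by
    have : Q * Uh = 0 := by
      rw [hQ, Matrix.sub_mul, Matrix.mul_assoc, hV1, Matrix.mul_one, Matrix.one_mul, sub_self]
    conv_lhs => rw [hQ]; rw [← hQ]; rw [Matrix.mul_sub, ← Matrix.mul_assoc, this]
    simp
  have hdk := esp_dk T That E hEdef U (esp_isom U hU1) Q hQh hQQ σsq g hgpos hcomm hG μ hTU hκ
  have hLL : Lmᴴ * Lm = 1 := (Matrix.mem_unitaryGroup_iff').mp hL
  have hRR : Rmᴴ * Rm = 1 := (Matrix.mem_unitaryGroup_iff').mp hR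
  have hRR' : Rm * Rmᴴ = 1 := (Matrix.mem_unitaryGroup_iff).mp hR
  set W := U * Lm with hW
  set V := Uh * Rm with hV
  have hWW : Wᴴ * W = 1 := by
    rw [hW, conjTranspose_mul, Matrix.mul_assoc, ← Matrix.mul_assoc Uᴴ, hU1, Matrix.one_mul, hLL]
  have hVV : Vᴴ * V = 1 := by
    rw [hV, conjTranspose_mul, Matrix.mul_assoc, ← Matrix.mul_assoc Uhᴴ, hV1, Matrix.one_mul, hRR]
  have hWV : Wᴴ * V = Matrix.diagonal (fun i => (s i : ℂ)) := by
    rw [hW, hV, conjTranspose_mul, Matrix.mul_assoc, ← Matrix.mul_assoc Uᴴ, hsvd,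
      Matrix.mul_assoc (Lm * _), hRR, Matrix.mul_one, ← Matrix.mul_assoc, hLL, Matrix.one_mul]
  have hcan := esp_canon W V hWW hVV s hs hWV
  have hQW : (1 - V * Vᴴ) * W = Q * U * Lm := by
    have : V * Vᴴ = Uh * Uhᴴ := by
      rw [hV, conjTranspose_mul, Matrix.mul_assoc, ← Matrix.mul_assoc Rm, hRR', Matrix.one_mul]
    rw [this, ← hQ, hW, Matrix.mul_assoc]
  have hQWn : ‖(1 - V * Vᴴ) * W‖ ≤ ‖Q * U‖ := by
    rw [hQW]
    refine (l2_opNorm_mul _ _).trans ?_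
    exact mul_le_of_le_one_right (norm_nonneg _) (esp_isom Lm hLL)
  set e := ‖E‖ with he
  set t := ‖Q * U‖ with ht
  have he0 : 0 ≤ e := norm_nonneg _
  have ht0 : 0 ≤ t := norm_nonneg _
  have hs2 : 0 < √2 := by positivity
  have hs2sq : √2 * √2 = 2 := Real.mul_self_sqrt (by norm_num)
  have hs2ge : 5 / 4 ≤ √2 := Real.le_sqrt_of_sq_le (by norm_num)
  have hW0 : ∀ x, σ0 * ‖x‖ ≤ ‖toEuclideanLin (rowsInit W) x‖ := esp_sval_full _
  have hσ0n : 0 ≤ σ0 := esp_sval_nonneg _ _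
  have hWn : ‖W‖ ≤ 1 := esp_isom W hWW
  have hσ01 : σ0 ≤ 1 := by
    refine Real.sSup_le ?_ zero_le_one
    rintro r ⟨_, V', hV', h⟩
    exact (esp_sval_mem_le _ S hS r V' hV' h).trans ((esp_init W).trans hWn)
  have hEb2 : e * (4 * √2) ≤ σ0 * g := by
    rw [le_div_iff₀ (by positivity)] at hEb
    have : σ0 * (g - σsq) ≤ σ0 * g := by gcongr; linarith
    linarith
  have he5 : 5 * e ≤ g := by
    have h1 : σ0 * g ≤ g := mul_le_of_le_one_left hgpos.le hσ01
    nlinarith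
  have htb : 4 * (g * t) ≤ 5 * e := by nlinarith
  have hδ : ‖V - W‖ ≤ √2 * (5 * e / (4 * g)) := by
    refine hcan.trans ?_
    gcongr
    refine hQWn.trans ?_
    rw [le_div_iff₀ (by positivity)]
    linarith
  set δ := √2 * (5 * e / (4 * g)) with hδdef
  have hδσ : δ ≤ 5 / 16 * σ0 := by
    rw [hδdef, mul_div_assoc', div_le_iff₀ (by positivity)]
    nlinarith
  rcases hσ0n.eq_or_lt with h0 | hpos
  · have hδ0 : ‖V - W‖ ≤ 0 := by rw [← h0] at hδσ; linarith
    have hVW : V = W := sub_eq_zero.mp (norm_le_zero_iff.mp hδ0)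
    rw [hVW, ← h0]
    simp
  · have hi : ‖rowsInit V - rowsInit W‖ ≤ δ := (esp_init (V - W)).trans hδ
    have htl : ‖rowsTail V - rowsTail W‖ ≤ δ := (esp_tail (V - W)).trans hδ
    have hV0 : ∀ x, (11 / 16 * σ0) * ‖x‖ ≤ ‖toEuclideanLin (rowsInit V) x‖ := by
      intro x
      have h1 := hW0 x
      have h2 := (esp_le (rowsInit V - rowsInit W) x).trans
        (mul_le_mul_of_nonneg_right (hi.trans hδσ) (norm_nonneg x))
      have h3 : toEuclideanLin (rowsInit W) x = toEuclideanLin (rowsInit V) x -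
          toEuclideanLin (rowsInit V - rowsInit W) x := by
        rw [map_sub, LinearMap.sub_apply]; abel
      have h4 : ‖toEuclideanLin (rowsInit W) x‖ ≤ ‖toEuclideanLin (rowsInit V) x‖ +
          ‖toEuclideanLin (rowsInit V - rowsInit W) x‖ := by
        rw [h3]; exact norm_sub_le _ _
      linarith
    have hmain := esp_lsq (rowsInit W) (rowsInit V) (rowsTail W) (rowsTail V) σ0 δ (11 / 16 * σ0)
      hpos (by positivity) hW0 hV0 hi htl ((esp_tail W).trans hWn)
    refine hmain.trans ?_
    have hδ0 : 0 ≤ δ := by positivity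
    have hd : 0 < q * a ^ 2 - σsq := by linarith
    have hb1 : δ / (11 / 16 * σ0) ≤ 16 / 11 * (δ / σ0 ^ 2) := by
      have : δ / σ0 ≤ δ / σ0 ^ 2 := by
        gcongr
        nlinarith
      calc δ / (11 / 16 * σ0) = 16 / 11 * (δ / σ0) := by field_simp
        _ ≤ _ := by gcongr
    have hb2 : δ / (11 / 16 * σ0 * σ0) = 16 / 11 * (δ / σ0 ^ 2) := by field_simp
    have hb3 : δ / (11 / 16 * σ0) ^ 2 = 256 / 121 * (δ / σ0 ^ 2) := by ring
    have hb4 : δ / σ0 ^ 2 ≤ 5 / 4 * (√2 * e / (σ0 ^ 2 * (q * a ^ 2 - σsq))) := by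
      calc δ / σ0 ^ 2 = 5 / 4 * (√2 * e / (σ0 ^ 2 * g)) := by rw [hδdef]; field_simp
        _ ≤ _ := by
          gcongr
          linarith
    have hb5 : 14 * √2 * e / (σ0 ^ 2 * (q * a ^ 2 - σsq)) =
      14 * (√2 * e / (σ0 ^ 2 * (q * a ^ 2 - σsq))) := by ring
    rw [hb5]
    have hb6 : 0 ≤ √2 * e / (σ0 ^ 2 * (q * a ^ 2 - σsq)) := by positivity
    linarith
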